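/- arXiv:2410.08032 — 2 statements merged into one kernel-verified Lean document; each statement's English description precedes it below -/
import Mathlib

section
/- Let X ⊆ ℝ^n be a compact convex set and Ω ⊆ ℝ^d a convex set, and let Ψ : ℝ^n × ℝ^d → ℝ be twice continuously differentiable. Suppose there is c > 0 such that pᵀ(∇²_x Ψ(x, ω))p ≤ −2c·‖p‖₂² for all x ∈ X, ω ∈ Ω, p ∈ ℝ^n, and let γ = sup_{x ∈ X, ω ∈ Ω} ‖∇²_{ωx} Ψ(x, ω)‖ + 1, where ‖·‖ is the operator norm of the mixed second-derivative matrix and the supremum is finite. Then for each ω ∈ Ω the maximizer x*(ω) of Ψ(·, ω) over X is unique, and the map ω ↦ x*(ω) is (γ/c)-Lipschitz on Ω with respect to the Euclidean norms: ‖x*(ω) − x*(ω')‖₂ ≤ (γ/c)·‖ω − ω'‖₂ for all ω, ω' ∈ Ω. -/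
/-- Let `X ⊆ ℝⁿ` be compact convex (nonempty so that maximizers
exist) and `Ω ⊆ ℝ^d` convex, and let `Ψ : ℝⁿ × ℝ^d → ℝ` be twice continuously
differentiable. Suppose `pᵀ(∇²ₓΨ(x, ω))p ≤ −2c·‖p‖₂²` for all `x ∈ X`, `ω ∈ Ω`,
`p ∈ ℝⁿ` with `c > 0`, and `γ` bounds `‖∇²_{ωx}Ψ(x, ω)‖ + 1` over `X × Ω` (so in
particular for `γ = sup ‖∇²_{ωx}Ψ‖ + 1` when the supremum is finite). Then for each
`ω ∈ Ω` the maximizer `x*(ω)` of `Ψ(·, ω)` over `X` is unique, and `ω ↦ x*(ω)` is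
`(γ/c)`-Lipschitz on `Ω`. -/
theorem argmax_lipschitz_in_parameter {n d : ℕ}
    (X : Set (EuclideanSpace ℝ (Fin n))) (Ω : Set (EuclideanSpace ℝ (Fin d)))
    (hXcpt : IsCompact X) (hXconv : Convex ℝ X) (hXne : X.Nonempty)
    (hΩ : Convex ℝ Ω)
    (Ψ : EuclideanSpace ℝ (Fin n) × EuclideanSpace ℝ (Fin d) → ℝ)
    (hΨ : ContDiff ℝ 2 Ψ)
    (c γ : ℝ) (hc : 0 < c)
    (hHess : ∀ x ∈ X, ∀ ω ∈ Ω, ∀ p : EuclideanSpace ℝ (Fin n),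
      iteratedFDeriv ℝ 2 (fun x' => Ψ (x', ω)) x ![p, p] ≤ -(2 * c) * ‖p‖ ^ 2)
    (hγ : ∀ x ∈ X, ∀ ω ∈ Ω,
      ‖fderiv ℝ (fun ω' => fderiv ℝ (fun x' => Ψ (x', ω')) x) ω‖ + 1 ≤ γ) :
    ∃ xstar : EuclideanSpace ℝ (Fin d) → EuclideanSpace ℝ (Fin n),
      (∀ ω ∈ Ω, xstar ω ∈ X ∧ IsMaxOn (fun x => Ψ (x, ω)) X (xstar ω) ∧
        ∀ y ∈ X, IsMaxOn (fun x => Ψ (x, ω)) X y → y = xstar ω) ∧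
      (∀ ω ∈ Ω, ∀ ω' ∈ Ω, ‖xstar ω - xstar ω'‖ ≤ (γ / c) * ‖ω - ω'‖) := by
  have hG : ∀ x ω, HasFDerivAt (fun x' => Ψ (x', ω))
      ((fderiv ℝ Ψ (x, ω)).comp (ContinuousLinearMap.inl ℝ _ _)) x := fun x ω =>
    ((hΨ.differentiable (by norm_num)) (x, ω)).hasFDerivAt.comp x (hasFDerivAt_prodMk_left x ω)
  have hGeq : ∀ x ω, fderiv ℝ (fun x' => Ψ (x', ω)) x =
      (fderiv ℝ Ψ (x, ω)).comp (ContinuousLinearMap.inl ℝ _ _) := fun x ω => (hG x ω).fderiv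
  have hF : ContDiff ℝ 1 (fderiv ℝ Ψ) := hΨ.fderiv_right (by norm_num)
  have hFd : Differentiable ℝ (fderiv ℝ Ψ) := hF.differentiable (by norm_num)
  have hdx : ∀ ω, Differentiable ℝ (fun x => fderiv ℝ (fun x' => Ψ (x', ω)) x) := by
    intro ω
    simp only [hGeq]
    fun_prop
  have hdω : ∀ x, Differentiable ℝ (fun ω => fderiv ℝ (fun x' => Ψ (x', ω)) x) := by
    intro x
    simp only [hGeq]
    fun_prop
  have hmono : ∀ x ∈ X, ∀ y ∈ X, ∀ ω ∈ Ω,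
      fderiv ℝ (fun x' => Ψ (x', ω)) x (x - y) - fderiv ℝ (fun x' => Ψ (x', ω)) y (x - y)
        ≤ -(2 * c) * ‖x - y‖ ^ 2 := by
    intro x hx y hy ω hω
    have hder : ∀ t : ℝ, HasDerivAt
        (fun t : ℝ => fderiv ℝ (fun x' => Ψ (x', ω)) (y + t • (x - y)) (x - y))
        (fderiv ℝ (fun z => fderiv ℝ (fun x' => Ψ (x', ω)) z) (y + t • (x - y)) (x - y) (x - y))
        t := by
      intro t
      have h1 : HasDerivAt (fun t : ℝ => y + t • (x - y)) (x - y) t := by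
        simpa using ((hasDerivAt_id t).smul_const (x - y)).const_add y
      have h2 := ((hdx ω) (y + t • (x - y))).hasFDerivAt.comp_hasDerivAt t h1
      simpa using h2.clm_apply (hasDerivAt_const t (x - y))
    obtain ⟨t, ht, hteq⟩ := exists_hasDerivAt_eq_slope _ _ (zero_lt_one (α := ℝ))
      (fun t _ => (hder t).continuousAt.continuousWithinAt) (fun t _ => hder t)
    have hmem : y + t • (x - y) ∈ X := by
      have := hXconv.add_smul_sub_mem hy hx (t := t) ⟨ht.1.le, ht.2.le⟩
      exact this
    have h3 := hHess _ hmem ω hω (x - y)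
    rw [iteratedFDeriv_two_apply] at h3
    simp only [Matrix.cons_val_zero, Matrix.cons_val_one] at h3
    simp only [one_smul, zero_smul, add_zero, sub_zero, div_one, add_sub_cancel] at hteq
    rw [← hteq]
    exact h3
  have hopt : ∀ x ∈ X, ∀ y ∈ X, ∀ ω, IsMaxOn (fun x => Ψ (x, ω)) X x →
      fderiv ℝ (fun x' => Ψ (x', ω)) x (y - x) ≤ 0 := by
    intro x hx y hy ω hm
    rw [hGeq]
    refine (IsMaxOn.localize hm).hasFDerivWithinAt_nonpos (hG x ω).hasFDerivWithinAt ?_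
    exact sub_mem_posTangentConeAt_of_segment_subset (hXconv.segment_subset hx hy)
  have key : ∀ x ∈ X, ∀ y ∈ X, ∀ ω ∈ Ω, ∀ ω' ∈ Ω, IsMaxOn (fun x => Ψ (x, ω)) X x →
      IsMaxOn (fun x => Ψ (x, ω')) X y → ‖x - y‖ ≤ (γ / c) * ‖ω - ω'‖ := by
    intro x hx y hy ω hω ω' hω' hmx hmy
    have h1 := hmono x hx y hy ω hω
    have h2 := hopt x hx y hy ω hmx
    have h3 := hopt y hy x hx ω' hmy
    have h4 : ‖fderiv ℝ (fun x' => Ψ (x', ω)) y - fderiv ℝ (fun x' => Ψ (x', ω')) y‖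
        ≤ (γ - 1) * ‖ω - ω'‖ :=
      hΩ.norm_image_sub_le_of_norm_fderiv_le (𝕜 := ℝ)
        (f := fun ω => fderiv ℝ (fun x' => Ψ (x', ω)) y)
        (fun w _ => hdω y w) (fun w hw => by linarith [hγ y hy w hw]) hω' hω
    have h5 := (fderiv ℝ (fun x' => Ψ (x', ω)) y - fderiv ℝ (fun x' => Ψ (x', ω')) y).le_of_opNorm_le
      h4 (x - y)
    have h6 := (le_abs_self _).trans h5
    rw [sub_apply] at h6
    rw [← neg_sub x y, map_neg] at h2
    have h7 : 2 * c * ‖x - y‖ ^ 2 ≤ (γ - 1) * ‖ω - ω'‖ * ‖x - y‖ := by linarith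
    have hγ1 : 1 ≤ γ := by
      have := hγ y hy ω hω
      linarith [norm_nonneg (fderiv ℝ (fun ω' => fderiv ℝ (fun x' => Ψ (x', ω')) y) ω)]
    rw [div_mul_eq_mul_div, le_div_iff₀ hc]
    have hnw := norm_nonneg (ω - ω')
    rcases (norm_nonneg (x - y)).eq_or_lt with h0 | h0
    · rw [← h0, zero_mul]
      positivity
    · have h8 : 2 * c * ‖x - y‖ ≤ (γ - 1) * ‖ω - ω'‖ := by
        refine le_of_mul_le_mul_right ?_ h0
        linarith
      nlinarith [mul_pos hc h0]
  have hex : ∀ ω, ∃ x ∈ X, IsMaxOn (fun x => Ψ (x, ω)) X x := fun ω =>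
    hXcpt.exists_isMaxOn hXne (by
      have := hΨ.continuous
      fun_prop)
  choose xs hxs hmax using hex
  refine ⟨xs, fun ω hω => ⟨hxs ω, hmax ω, fun y hy hym => ?_⟩, fun ω hω ω' hω' =>
    key _ (hxs ω) _ (hxs ω') ω hω ω' hω' (hmax ω) (hmax ω')⟩
  have := key y hy _ (hxs ω) ω hω ω hω hym (hmax ω)
  rw [sub_self, norm_zero, mul_zero] at this
  exact sub_eq_zero.1 (norm_le_zero_iff.1 this)
end

section
/- Let Φ : ℝ^m × ℝ^d → ℝ be twice continuously differentiable with the Hessian ∇²_x Φ(x, ω) negative definite for all (x, ω), and for each ω ∈ ℝ^d let x*(ω) denote the unique maximizer of Φ(·, ω) over the box [0,1]^m. Fix ω₀ ∈ ℝ^d and suppose strict complementarity holds at ω₀: for every coordinate i ∈ {1,…,m}, it is not the case that (x*_i(ω₀) = 1 and ∂Φ/∂x_i(x*(ω₀), ω₀) = 0), and it is not the case that (x*_i(ω₀) = 0 and ∂Φ/∂x_i(x*(ω₀), ω₀) = 0). Then the map ω ↦ x*(ω) is differentiable at ω₀. -/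
open Filter Topology

/-- Negative definite second derivative: two maximizers over a convex set coincide. -/
lemma aux_unique {E : Type*} [NormedAddCommGroup E] [NormedSpace ℝ E] {f : E → ℝ}
    (hf : ContDiff ℝ 2 f) (hH : ∀ x p : E, p ≠ 0 → fderiv ℝ (fderiv ℝ f) x p p < 0)
    {s : Set E} (hs : Convex ℝ s) {x y : E} (hx : x ∈ s) (hy : y ∈ s)
    (hmx : IsMaxOn f s x) (hxy : f x ≤ f y) : y = x := by
  by_contra hne
  have hv : y - x ≠ 0 := sub_ne_zero.mpr hne
  have hd : Differentiable ℝ f := hf.differentiable (by norm_num)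
  have hd2 : Differentiable ℝ (fderiv ℝ f) :=
    (hf.fderiv_right (m := 1) (by norm_num)).differentiable (by norm_num)
  have hline : ∀ t : ℝ, HasDerivAt (fun t : ℝ => x + t • (y - x)) (y - x) t := by
    intro t
    simpa using ((hasDerivAt_id t).smul_const (y - x)).const_add x
  have h1 : ∀ t : ℝ, HasDerivAt (fun t : ℝ => f (x + t • (y - x)))
      (fderiv ℝ f (x + t • (y - x)) (y - x)) t := fun t =>
    (hd _).hasFDerivAt.comp_hasDerivAt t (hline t)
  have h2 : ∀ t : ℝ, HasDerivAt (fun t : ℝ => fderiv ℝ f (x + t • (y - x)) (y - x))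
      (fderiv ℝ (fderiv ℝ f) (x + t • (y - x)) (y - x) (y - x)) t := by
    intro t
    have := ((hd2 _).hasFDerivAt.comp_hasDerivAt t (hline t))
    simpa using this.clm_apply (hasDerivAt_const t (y - x))
  have hd1 : deriv (fun t : ℝ => f (x + t • (y - x))) =
      fun t : ℝ => fderiv ℝ f (x + t • (y - x)) (y - x) := funext fun t => (h1 t).deriv
  have hconc : StrictConcaveOn ℝ Set.univ (fun t : ℝ => f (x + t • (y - x))) := by
    apply strictConcaveOn_univ_of_deriv2_neg
    · exact continuous_iff_continuousAt.mpr fun t => (h1 t).continuousAt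
    · intro t
      simp only [Function.iterate_succ, Function.iterate_zero, Function.comp, id]
      rw [hd1, (h2 t).deriv]
      exact hH _ _ hv
  have h3 := hconc.2 (Set.mem_univ (0 : ℝ)) (Set.mem_univ (1 : ℝ)) (by norm_num)
    (show (0 : ℝ) < 1 / 2 by norm_num) (show (0 : ℝ) < 1 / 2 by norm_num) (by norm_num)
  have h4 : x + (1 / 2 : ℝ) • (y - x) ∈ s :=
    hs.add_smul_sub_mem hx hy ⟨by norm_num, by norm_num⟩
  have h5 : f (x + (1 / 2 : ℝ) • (y - x)) ≤ f x := hmx h4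
  simp only [smul_eq_mul, mul_zero, zero_smul, add_zero, zero_add, mul_one, one_smul,
    add_sub_cancel] at h3
  linarith

lemma aux_convex (m : ℕ) :
    Convex ℝ {x : EuclideanSpace ℝ (Fin m) | ∀ i, x i ∈ Set.Icc (0 : ℝ) 1} := by
  intro x hx y hy a b ha hb hab i
  have := convex_Icc (0 : ℝ) 1 (hx i) (hy i) ha hb hab
  simpa using this

lemma aux_compact (m : ℕ) :
    IsCompact {x : EuclideanSpace ℝ (Fin m) | ∀ i, x i ∈ Set.Icc (0 : ℝ) 1} := by
  have h := (isCompact_univ_pi (fun _ : Fin m => isCompact_Icc (a := (0 : ℝ)) (b := 1)))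
  have h2 := (EuclideanSpace.equiv (Fin m) ℝ).toHomeomorph.isCompact_preimage.mpr h
  convert h2 using 1
  ext x
  exact ⟨fun hx i _ => hx i, fun hx i => hx i (Set.mem_univ i)⟩

lemma aux_kkt {m : ℕ} {f : EuclideanSpace ℝ (Fin m) → ℝ} {x : EuclideanSpace ℝ (Fin m)}
    (hf : DifferentiableAt ℝ f x) (hx : ∀ i, x i ∈ Set.Icc (0 : ℝ) 1)
    (hmax : IsMaxOn f {x : EuclideanSpace ℝ (Fin m) | ∀ i, x i ∈ Set.Icc (0 : ℝ) 1} x)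
    (i : Fin m) :
    (x i < 1 → fderiv ℝ f x (EuclideanSpace.single i 1) ≤ 0) ∧
    (0 < x i → 0 ≤ fderiv ℝ f x (EuclideanSpace.single i 1)) := by
  have key : ∀ c : ℝ, x i + c ∈ Set.Icc (0 : ℝ) 1 →
      c * fderiv ℝ f x (EuclideanSpace.single i 1) ≤ 0 := by
    intro c hc
    have hmem : x + c • EuclideanSpace.single i (1 : ℝ) ∈
        {x : EuclideanSpace ℝ (Fin m) | ∀ i, x i ∈ Set.Icc (0 : ℝ) 1} := by
      intro j
      by_cases hj : j = i
      · subst hj; simpa using hc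
      · simpa [hj] using hx j
    have := hmax.localize.hasFDerivWithinAt_nonpos hf.hasFDerivAt.hasFDerivWithinAt
      (mem_posTangentConeAt_of_segment_subset ((aux_convex m).segment_subset hx hmem))
    simpa using this
  constructor
  · intro h
    have := key (1 - x i) (by simp)
    nlinarith
  · intro h
    have := key (- x i) (by simp)
    nlinarith

/-- Second partial derivative in terms of the full second derivative. -/
lemma aux_snd {E W : Type*} [NormedAddCommGroup E] [NormedSpace ℝ E]
    [NormedAddCommGroup W] [NormedSpace ℝ W] {D : E × W → (E × W →L[ℝ] ℝ)}
    (hd2 : Differentiable ℝ D) (x : E) (ω : W) (p q : E) :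
    fderiv ℝ (fun x => D (x, ω) ∘L ContinuousLinearMap.inl ℝ E W) x p q =
      fderiv ℝ D (x, ω) (p, 0) (q, 0) := by
  have h1 : HasFDerivAt (fun x => D (x, ω)) (fderiv ℝ D (x, ω) ∘L .inl ℝ E W) x :=
    (hd2 (x, ω)).hasFDerivAt.comp x (hasFDerivAt_prodMk_left x ω)
  have h := h1.clm_comp (hasFDerivAt_const (ContinuousLinearMap.inl ℝ E W) x)
  rw [h.fderiv]
  simp

lemma aux_swap {E W : Type*} [NormedAddCommGroup E] [NormedSpace ℝ E]
    [NormedAddCommGroup W] [NormedSpace ℝ W] {D : E × W → (E × W →L[ℝ] ℝ)}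
    (hd2 : Differentiable ℝ D) (x : E) (ω : W) (v : E) (e : E × W) :
    fderiv ℝ (fun q : W × E => D (q.2, q.1) e) (ω, x) (0, v) =
      fderiv ℝ D (x, ω) (v, 0) e := by
  have hsw : HasFDerivAt (fun q : W × E => (q.2, q.1))
      ((ContinuousLinearMap.snd ℝ W E).prod (ContinuousLinearMap.fst ℝ W E))
      (ω, x) := hasFDerivAt_snd.prodMk hasFDerivAt_fst
  have h1 : HasFDerivAt (fun q : W × E => D (q.2, q.1)) (fderiv ℝ D (x, ω) ∘L
      ((ContinuousLinearMap.snd ℝ W E).prod (ContinuousLinearMap.fst ℝ W E))) (ω, x) :=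
    HasFDerivAt.comp (g := D) (ω, x) (hd2 (x, ω)).hasFDerivAt hsw
  have h := h1.clm_apply (hasFDerivAt_const e (ω, x))
  rw [h.fderiv]
  simp

set_option maxHeartbeats 1000000 in
/-- Let `Φ : ℝ^m × ℝ^d → ℝ` be twice continuously differentiable
with `∇²ₓΦ(x, ω)` negative definite for all `(x, ω)`, and for each `ω` let `x*(ω)`
denote the (unique) maximizer of `Φ(·, ω)` over the box `[0,1]^m`. If strict
complementarity holds at `ω₀` — no coordinate `i` has `x*ᵢ(ω₀) ∈ {0, 1}` together
with a vanishing partial derivative `∂Φ/∂xᵢ(x*(ω₀), ω₀) = 0` (i.e. no active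
constraint has zero KKT multiplier) — then `ω ↦ x*(ω)` is differentiable at `ω₀`. -/
theorem argmax_differentiable_of_strict_complementarity {m d : ℕ}
    (Φ : EuclideanSpace ℝ (Fin m) × EuclideanSpace ℝ (Fin d) → ℝ)
    (hΦ : ContDiff ℝ 2 Φ)
    (hHess : ∀ (x : EuclideanSpace ℝ (Fin m)) (ω : EuclideanSpace ℝ (Fin d))
      (p : EuclideanSpace ℝ (Fin m)), p ≠ 0 →
      iteratedFDeriv ℝ 2 (fun x' => Φ (x', ω)) x ![p, p] < 0)
    (xstar : EuclideanSpace ℝ (Fin d) → EuclideanSpace ℝ (Fin m))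
    (hmem : ∀ ω i, xstar ω i ∈ Set.Icc (0 : ℝ) 1)
    (hmax : ∀ ω, IsMaxOn (fun x => Φ (x, ω))
      {x : EuclideanSpace ℝ (Fin m) | ∀ i, x i ∈ Set.Icc (0 : ℝ) 1} (xstar ω))
    (ω₀ : EuclideanSpace ℝ (Fin d))
    (hsc : ∀ i : Fin m,
      ¬(xstar ω₀ i = 1 ∧
        fderiv ℝ (fun x => Φ (x, ω₀)) (xstar ω₀) (EuclideanSpace.single i 1) = 0) ∧
      ¬(xstar ω₀ i = 0 ∧
        fderiv ℝ (fun x => Φ (x, ω₀)) (xstar ω₀) (EuclideanSpace.single i 1) = 0)) :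
    DifferentiableAt ℝ xstar ω₀ := by
  have hd : Differentiable ℝ Φ := hΦ.differentiable (by norm_num)
  have hC1 : ContDiff ℝ 1 (fderiv ℝ Φ) := hΦ.fderiv_right (by norm_num)
  have hd2 : Differentiable ℝ (fderiv ℝ Φ) := hC1.differentiable (by norm_num)
  have hpd : ∀ x ω, HasFDerivAt (fun x => Φ (x, ω))
      (fderiv ℝ Φ (x, ω) ∘L .inl ℝ _ _) x := fun x ω =>
    (hd (x, ω)).hasFDerivAt.comp x (hasFDerivAt_prodMk_left x ω)
  have hpd1 : ∀ ω, fderiv ℝ (fun x => Φ (x, ω)) =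
      fun x => fderiv ℝ Φ (x, ω) ∘L .inl ℝ _ _ := fun ω => funext fun x => (hpd x ω).fderiv
  have hpd2 : ∀ x ω p q, fderiv ℝ (fderiv ℝ (fun x => Φ (x, ω))) x p q =
      fderiv ℝ (fderiv ℝ Φ) (x, ω) (p, 0) (q, 0) := by
    intro x ω p q
    rw [hpd1]
    exact aux_snd hd2 x ω p q
  have hneg : ∀ x ω p, p ≠ 0 → fderiv ℝ (fderiv ℝ Φ) (x, ω) (p, 0) (p, 0) < 0 := by
    intro x ω p hp
    have := hHess x ω p hp
    rw [iteratedFDeriv_two_apply] at this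
    simpa [hpd2] using this
  -- continuity of the maximizer
  have hcont : Tendsto xstar (𝓝 ω₀) (𝓝 (xstar ω₀)) := by
    refine (aux_compact m).tendsto_nhds_of_unique_mapClusterPt
      (Eventually.of_forall fun ω => hmem ω) ?_
    intro y hy hcl
    have hle : Φ (xstar ω₀, ω₀) ≤ Φ (y, ω₀) := by
      obtain ⟨U, hU, hUy⟩ := mapClusterPt_iff_ultrafilter.mp hcl
      have hcl2 : Tendsto (fun ω => (xstar ω, ω)) U (𝓝 (y, ω₀)) := by
        rw [nhds_prod_eq]; exact hUy.prodMk hU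
      have hclosed : IsClosed {q : EuclideanSpace ℝ (Fin m) × EuclideanSpace ℝ (Fin d) |
          Φ (xstar ω₀, q.2) ≤ Φ q} :=
        isClosed_le (by have := hd.continuous; fun_prop) hd.continuous
      exact hclosed.mem_of_tendsto hcl2
        (Eventually.of_forall fun ω => hmax ω (hmem ω₀))
    refine aux_unique (f := fun x => Φ (x, ω₀)) (by fun_prop) ?_ (aux_convex m)
      (hmem ω₀) hy (hmax ω₀) hle
    intro x p hp
    rw [hpd2]
    exact hneg _ _ _ hp
  have hcont2 : Tendsto (fun ω => (ω, xstar ω)) (𝓝 ω₀) (𝓝 (ω₀, xstar ω₀)) := by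
    rw [nhds_prod_eq]; exact tendsto_id.prodMk hcont
  -- partial derivatives
  let g : Fin m → EuclideanSpace ℝ (Fin d) × EuclideanSpace ℝ (Fin m) → ℝ :=
    fun i q => fderiv ℝ Φ (q.2, q.1) (EuclideanSpace.single i 1, 0)
  have hgeq : ∀ i ω, fderiv ℝ (fun x => Φ (x, ω)) (xstar ω) (EuclideanSpace.single i 1) =
      g i (ω, xstar ω) := by
    intro i ω
    rw [hpd1]
    simp [g]
  have hkkt : ∀ i ω, (xstar ω i < 1 → g i (ω, xstar ω) ≤ 0) ∧
      (0 < xstar ω i → 0 ≤ g i (ω, xstar ω)) := by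
    intro i ω
    rw [← hgeq]
    exact aux_kkt (hpd _ ω).differentiableAt (hmem ω) (hmax ω) i
  have hgC : ∀ i, ContDiff ℝ 1 (g i) := fun i =>
    (hC1.comp (contDiff_snd.prodMk contDiff_fst)).clm_apply contDiff_const
  have hgd : ∀ i, HasStrictFDerivAt (g i) (fderiv ℝ (g i) (ω₀, xstar ω₀)) (ω₀, xstar ω₀) :=
    fun i => (hgC i).contDiffAt.hasStrictFDerivAt (by norm_num)
  have hg' : ∀ i v, fderiv ℝ (g i) (ω₀, xstar ω₀) (0, v) =
      fderiv ℝ (fderiv ℝ Φ) (xstar ω₀, ω₀) (v, 0) (EuclideanSpace.single i 1, 0) := by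
    intro i v
    exact aux_swap hd2 _ _ _ _
  have hgt : ∀ i, Tendsto (fun ω => g i (ω, xstar ω)) (𝓝 ω₀) (𝓝 (g i (ω₀, xstar ω₀))) :=
    fun i => ((hgC i).continuous.tendsto _).comp hcont2
  have hxt : ∀ i, Tendsto (fun ω => xstar ω i) (𝓝 ω₀) (𝓝 (xstar ω₀ i)) := fun i =>
    ((EuclideanSpace.proj i : EuclideanSpace ℝ (Fin m) →L[ℝ] ℝ).continuous.tendsto _).comp hcont
  -- the KKT system
  classical
  let free : Fin m → Prop := fun i => 0 < xstar ω₀ i ∧ xstar ω₀ i < 1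
  let F : EuclideanSpace ℝ (Fin d) × EuclideanSpace ℝ (Fin m) → (Fin m → ℝ) :=
    fun q i => if free i then g i q else q.2 i
  let F' : EuclideanSpace ℝ (Fin d) × EuclideanSpace ℝ (Fin m) →L[ℝ] (Fin m → ℝ) :=
    ContinuousLinearMap.pi fun i => if free i then fderiv ℝ (g i) (ω₀, xstar ω₀) else
      (EuclideanSpace.proj i : EuclideanSpace ℝ (Fin m) →L[ℝ] ℝ) ∘L
        ContinuousLinearMap.snd ℝ _ _
  have hF : HasStrictFDerivAt F F' (ω₀, xstar ω₀) := by
    refine hasStrictFDerivAt_pi.mpr fun i => ?_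
    by_cases hi : free i
    · simpa only [F, hi, if_true] using hgd i
    · simp only [hi, if_false]
      exact ((EuclideanSpace.proj i : EuclideanSpace ℝ (Fin m) →L[ℝ] ℝ) ∘L
          ContinuousLinearMap.snd ℝ (EuclideanSpace ℝ (Fin d)) _).hasStrictFDerivAt
            (x := (ω₀, xstar ω₀))
  have hinj : Function.Injective (F' ∘L .inr ℝ _ _) := by
    rw [injective_iff_map_eq_zero]
    intro v hv
    by_contra hne
    have hlt := hneg (xstar ω₀) ω₀ v hne
    have hcomp : ∀ i, v i * fderiv ℝ (fderiv ℝ Φ) (xstar ω₀, ω₀) (v, 0)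
        (EuclideanSpace.single i 1, 0) = 0 := by
      intro i
      have hvi := congrFun hv i
      by_cases hi : free i
      · have : fderiv ℝ (g i) (ω₀, xstar ω₀) (0, v) = 0 := by simpa [F', hi] using hvi
        rw [← hg', this, mul_zero]
      · have : v i = 0 := by simpa [F', hi] using hvi
        rw [this, zero_mul]
    have hsum : ((v, 0) : EuclideanSpace ℝ (Fin m) × EuclideanSpace ℝ (Fin d)) =
        ∑ i, v i • ((EuclideanSpace.single i (1 : ℝ), 0) :
          EuclideanSpace ℝ (Fin m) × EuclideanSpace ℝ (Fin d)) := by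
      refine Prod.ext ?_ ?_
      · rw [Prod.fst_sum]
        ext j
        simp [Finset.sum_apply, Pi.single_apply]
      · rw [Prod.snd_sum]; simp
    have h0 : fderiv ℝ (fderiv ℝ Φ) (xstar ω₀, ω₀) (v, 0) (v, 0) = 0 := by
      generalize fderiv ℝ (fderiv ℝ Φ) (xstar ω₀, ω₀) (v, 0) = L at hcomp ⊢
      rw [hsum, map_sum]
      exact Finset.sum_eq_zero fun i _ => by rw [map_smul, smul_eq_mul, hcomp i]
    linarith
  have hinv : (F' ∘L .inr ℝ _ _).IsInvertible := by
    refine ⟨(LinearMap.linearEquivOfInjective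
      ((F' ∘L .inr ℝ _ _ : _ →L[ℝ] _) : EuclideanSpace ℝ (Fin m) →ₗ[ℝ] (Fin m → ℝ)) hinj
      (by simp)).toContinuousLinearEquiv, ?_⟩
    ext v i
    rfl
  have hev : ∀ᶠ ω in 𝓝 ω₀, F (ω, xstar ω) = F (ω₀, xstar ω₀) := by
    have : ∀ i, ∀ᶠ ω in 𝓝 ω₀, F (ω, xstar ω) i = F (ω₀, xstar ω₀) i := by
      intro i
      by_cases hi : free i
      · have h00 := le_antisymm ((hkkt i ω₀).1 hi.2) ((hkkt i ω₀).2 hi.1)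
        filter_upwards [(hxt i).eventually_const_lt hi.1, (hxt i).eventually_lt_const hi.2]
          with ω h1 h2
        simp only [F, hi, if_true]
        rw [h00]
        exact le_antisymm ((hkkt i ω).1 h2) ((hkkt i ω).2 h1)
      · simp only [F, hi, if_false]
        obtain ⟨hs1, hs0⟩ := hsc i
        rw [hgeq] at hs1 hs0
        have hm := hmem ω₀ i
        rcases hm.1.eq_or_lt with h0 | h0
        · have hlt : g i (ω₀, xstar ω₀) < 0 :=
            lt_of_le_of_ne ((hkkt i ω₀).1 (by rw [← h0]; norm_num))
              fun h => hs0 ⟨h0.symm, h⟩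
          filter_upwards [(hgt i).eventually_lt_const hlt] with ω hω
          rw [← h0]
          by_contra hne
          exact absurd ((hkkt i ω).2 (lt_of_le_of_ne (hmem ω i).1 (Ne.symm hne)))
            (not_le.mpr hω)
        · have h1 : xstar ω₀ i = 1 := le_antisymm hm.2 (not_lt.mp fun h => hi ⟨h0, h⟩)
          have hlt : 0 < g i (ω₀, xstar ω₀) :=
            lt_of_le_of_ne ((hkkt i ω₀).2 h0) fun h => hs1 ⟨h1, h.symm⟩
          filter_upwards [(hgt i).eventually_const_lt hlt] with ω hω
          rw [h1]
          by_contra hne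
          exact absurd ((hkkt i ω).1 (lt_of_le_of_ne (hmem ω i).2 hne)) (not_le.mpr hω)
    filter_upwards [eventually_all.mpr this] with ω hω
    exact funext hω
  have himp := hcont2.eventually
    (hF.eventually_apply_eq_iff_implicitFunctionOfProdDomain hinv)
  refine (hF.hasStrictFDerivAt_implicitFunctionOfProdDomain hinv).hasFDerivAt.differentiableAt.congr_of_eventuallyEq ?_
  filter_upwards [himp, hev] with ω h1 h2
  exact (h1.mp h2).symm
end
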